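/- Lemma 3.8, part 3 (concentration of the right-projected truncated initialization, fixed threshold). There exists a universal constant c > 0 such that the following holds. Assume Assumption 1 and let the a_ki and y_ki be as in the context, with C̃ := 9κ²μ². Fix ε₁ ∈ (0,1), a deterministic threshold α with C̃(1 − ε₁)‖X*‖_F²/q ≤ α ≤ C̃(1 + ε₁)‖X*‖_F²/q, and a deterministic r×q real matrix V with orthonormal rows (VVᵀ = I_r). Let X̂₀(α) := (1/m)·Σ_{k,i} a_ki·y_ki·1{y_ki² ≤ α}·e_kᵀ and let D(α) be the q×q diagonal matrix with entries β_k(α) := E[ζ²·1{‖x*_k‖²ζ² ≤ α}] (ζ standard Gaussian). Then with probability at least 1 − exp(nr − c·ε₁²·mq/(μ²κ²)), ‖(X̂₀(α) − X*·D(α))·Vᵀ‖_F ≤ 1.1·ε₁·‖X*‖_F. -/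

import Mathlib

open MeasureTheory ProbabilityTheory Matrix
open scoped ENNReal

noncomputable section

/-- Euclidean norm of a finitely-indexed real vector. -/
def vnorm {ι : Type*} [Fintype ι] (v : ι → ℝ) : ℝ := Real.sqrt (∑ i, v i ^ 2)

/-- Frobenius norm of a real matrix. -/
def frob {ι ι' : Type*} [Fintype ι] [Fintype ι'] (M : Matrix ι ι' ℝ) : ℝ :=
  Real.sqrt (∑ i, ∑ j, M i j ^ 2)

/-- Spectral (ℓ2 operator) norm of a real matrix. -/
def spec {ι ι' : Type*} [Fintype ι] [Fintype ι'] (M : Matrix ι ι' ℝ) : ℝ :=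
  sSup {c | ∃ z, vnorm z = 1 ∧ c = vnorm (M.mulVec z)}

/-- Smallest singular value of an r×q matrix with r ≤ q (or of a square matrix):
the minimum of ‖Bᵀw‖ over unit vectors w. -/
def sigMin {ι ι' : Type*} [Fintype ι] [Fintype ι'] (B : Matrix ι ι' ℝ) : ℝ :=
  sInf {c | ∃ w, vnorm w = 1 ∧ c = vnorm (Bᵀ.mulVec w)}

/-- The k-th column of a matrix. -/
def matCol {ι ι' : Type*} (B : Matrix ι ι' ℝ) (k : ι') : ι → ℝ := fun i => B i k

/-- Subspace distance SD(U₁,U₂) := ‖(I − U₁U₁ᵀ)U₂‖_F. -/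
def SD {n r : ℕ} (U₁ U₂ : Matrix (Fin n) (Fin r) ℝ) : ℝ :=
  frob ((1 - U₁ * U₁ᵀ) * U₂)

/-- The standard Gaussian measure on ℝ. -/
def stdGaussian : Measure ℝ := gaussianReal 0 1

instance : IsProbabilityMeasure stdGaussian :=
  inferInstanceAs (IsProbabilityMeasure (gaussianReal 0 1))

/-- A standard Gaussian random vector in ℝⁿ (i.i.d. N(0,1) coordinates). -/
def gaussianVec (n : ℕ) : Measure (Fin n → ℝ) := Measure.pi fun _ => stdGaussian

instance (n : ℕ) : IsProbabilityMeasure (gaussianVec n) := by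
  unfold gaussianVec; infer_instance

/-- i.i.d. standard Gaussian random vectors a_{k i} ∈ ℝⁿ, k ∈ [q], i ∈ [m]. -/
def gaussianMatrices (q m n : ℕ) : Measure (Fin q → Fin m → Fin n → ℝ) :=
  Measure.pi fun _ => Measure.pi fun _ => gaussianVec n

instance (q m n : ℕ) : IsProbabilityMeasure (gaussianMatrices q m n) := by
  unfold gaussianMatrices; infer_instance

/-- Truncated spectral-initialization matrix X̂₀ = (1/m) Σ_{k,i} a_ki y_ki 1{y_ki² ≤ α} e_kᵀ. -/
def initMat {n q m : ℕ} (xstar : Fin q → Fin n → ℝ) (α : ℝ)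
    (ω : Fin q → Fin m → Fin n → ℝ) : Matrix (Fin n) (Fin q) ℝ :=
  Matrix.of fun j k => (1 / (m : ℝ)) * ∑ i, ω k i j * (ω k i ⬝ᵥ xstar k) *
    (if (ω k i ⬝ᵥ xstar k) ^ 2 ≤ α then 1 else 0)

/-- Data-dependent truncation threshold α := C̃ Σ_{k,i} y_ki² / (mq). -/
def initAlpha {n q m : ℕ} (xstar : Fin q → Fin n → ℝ) (Ctil : ℝ)
    (ω : Fin q → Fin m → Fin n → ℝ) : ℝ :=
  Ctil * ((∑ k, ∑ i, (ω k i ⬝ᵥ xstar k) ^ 2) / ((m : ℝ) * q))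

/-- β(α) := E[ζ² 1{‖x‖² ζ² ≤ α}] for ζ standard Gaussian. -/
def betaK (normx α : ℝ) : ℝ :=
  ∫ z, z ^ 2 * (if normx ^ 2 * z ^ 2 ≤ α then 1 else 0) ∂stdGaussian

/-- The least-squares estimate b̂ := (UᵀAᵀAU)⁻¹ Uᵀ Aᵀ A x. -/
def lsEst {n r m : ℕ} (U : Matrix (Fin n) (Fin r) ℝ) (A : Matrix (Fin m) (Fin n) ℝ)
    (x : Fin n → ℝ) : Fin r → ℝ :=
  ((Uᵀ * Aᵀ * A * U)⁻¹ * Uᵀ * Aᵀ * A).mulVec x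

/-- Gradient w.r.t. U of the squared loss: Σ_k Aᵀ(AUb̂_k − Ax*_k)b̂_kᵀ. -/
def gradU {n r q m : ℕ} (U : Matrix (Fin n) (Fin r) ℝ)
    (A : Fin q → Matrix (Fin m) (Fin n) ℝ) (xstar : Fin q → Fin n → ℝ)
    (bhat : Fin q → Fin r → ℝ) : Matrix (Fin n) (Fin r) ℝ :=
  ∑ k, (A k)ᵀ * vecMulVec ((A k).mulVec (U.mulVec (bhat k) - xstar k)) (bhat k)

/-- `U` has orthonormal columns whose span is the span of eigenvectors of `S`
corresponding to its `r` largest eigenvalues: `S` maps the column span of `U` into itself,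
and wᵀSw ≥ zᵀSz for unit w in the span and unit z orthogonal to it. -/
def IsTopREigenBasis {n r : ℕ} (S : Matrix (Fin n) (Fin n) ℝ)
    (U : Matrix (Fin n) (Fin r) ℝ) : Prop :=
  Uᵀ * U = 1 ∧ (∃ M : Matrix (Fin r) (Fin r) ℝ, S * U = U * M) ∧
  ∀ w z : Fin n → ℝ, (∃ cvec : Fin r → ℝ, w = U.mulVec cvec) → Uᵀ.mulVec z = 0 →
    vnorm w = 1 → vnorm z = 1 → z ⬝ᵥ S.mulVec z ≤ w ⬝ᵥ S.mulVec w

/-- Sample sizes for the 2T+1 sample splits: batch τ ∈ {0,…,T} has m τ rows,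
batch τ = T + t (t ∈ {1,…,T}) has m t rows. -/
def msize (m : ℕ → ℕ) (T τ : ℕ) : ℕ := if τ ≤ T then m τ else m (τ - T)

/-- The joint distribution of all 2T+1 independent sample batches of i.i.d. standard
Gaussian measurement vectors. -/
def splitGauss (m : ℕ → ℕ) (T q n : ℕ) :
    Measure (∀ τ : Fin (2 * T + 1), Fin q → Fin (msize m T τ.1) → Fin n → ℝ) :=
  Measure.pi fun τ => gaussianMatrices q (msize m T τ.1) n

instance (m : ℕ → ℕ) (T q n : ℕ) : IsProbabilityMeasure (splitGauss m T q n) := by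
  unfold splitGauss; infer_instance

end

section GaussianVec

variable {n : ℕ}

lemma map_eval_gaussianVec (i : Fin n) :
    (gaussianVec n).map (fun a => a i) = gaussianReal 0 1 :=
  (measurePreserving_eval (fun _ : Fin n => gaussianReal 0 1) i).map_eq

lemma hasGaussianLaw_eval_gaussianVec (i : Fin n) :
    HasGaussianLaw (fun a : Fin n → ℝ => a i) (gaussianVec n) where
  isGaussian_map := by
    rw [map_eval_gaussianVec]
    infer_instance

lemma iIndepFun_eval_gaussianVec :
    iIndepFun (fun (i : Fin n) (a : Fin n → ℝ) => a i) (gaussianVec n) :=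
  iIndepFun_pi (μ := fun _ : Fin n => gaussianReal 0 1) (X := fun _ x => x)
    (fun _ => aemeasurable_id)

lemma hasGaussianLaw_id_gaussianVec :
    HasGaussianLaw (fun a : Fin n → ℝ => fun i => a i) (gaussianVec n) :=
  iIndepFun_eval_gaussianVec.hasGaussianLaw hasGaussianLaw_eval_gaussianVec

lemma covariance_eval_gaussianVec (i j : Fin n) :
    cov[fun a : Fin n → ℝ => a i, fun a => a j; gaussianVec n] = if i = j then 1 else 0 := by
  split_ifs with h
  · subst h
    have hm := (measurable_pi_apply (X := fun _ : Fin n => ℝ) i).aemeasurable (μ := gaussianVec n)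
    have h := variance_map (X := id) aemeasurable_id hm
    rw [map_eval_gaussianVec, variance_id_gaussianReal] at h
    rw [covariance_self hm]
    simpa [Function.comp_def] using h.symm
  · exact (iIndepFun_eval_gaussianVec.indepFun h).covariance_eq_zero
      (hasGaussianLaw_eval_gaussianVec i).memLp_two (hasGaussianLaw_eval_gaussianVec j).memLp_two

lemma covariance_dotProduct_gaussianVec (u v : Fin n → ℝ) :
    cov[fun a : Fin n → ℝ => a ⬝ᵥ u, fun a => a ⬝ᵥ v; gaussianVec n] = u ⬝ᵥ v := by
  simp only [dotProduct]
  rw [covariance_fun_sum_fun_sum]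
  · simp [covariance_mul_const_left, covariance_mul_const_right, covariance_eval_gaussianVec]
  all_goals exact fun i => (hasGaussianLaw_eval_gaussianVec i).memLp_two.mul_const _

lemma hasGaussianLaw_dotProduct_prodMk (u v : Fin n → ℝ) :
    HasGaussianLaw (fun a : Fin n → ℝ => (a ⬝ᵥ u, a ⬝ᵥ v)) (gaussianVec n) := by
  let f (w : Fin n → ℝ) : (Fin n → ℝ) →L[ℝ] ℝ :=
    ∑ i, w i • ContinuousLinearMap.proj (R := ℝ) (φ := fun _ : Fin n => ℝ) i
  have hf : (fun a : Fin n → ℝ => (a ⬝ᵥ u, a ⬝ᵥ v)) = fun a => (f u).prod (f v) fun i => a i := by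
    ext a <;> simp [f, dotProduct, mul_comm]
  rw [hf]
  exact hasGaussianLaw_id_gaussianVec.map_fun ((f u).prod (f v))

lemma integral_dotProduct_gaussianVec (u : Fin n → ℝ) :
    ∫ a, a ⬝ᵥ u ∂gaussianVec n = 0 := by
  simp only [dotProduct]
  rw [integral_finsetSum _ fun i _ => ((hasGaussianLaw_eval_gaussianVec i).integrable.mul_const _)]
  refine Finset.sum_eq_zero fun i _ => ?_
  have h := integral_map (μ := gaussianVec n) (f := id) (measurable_pi_apply i).aemeasurable
    aestronglyMeasurable_id
  rw [map_eval_gaussianVec] at h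
  simp only [id, integral_id_gaussianReal] at h
  rw [integral_mul_const, ← h, zero_mul]

lemma map_dotProduct_gaussianVec (u : Fin n → ℝ) :
    (gaussianVec n).map (fun a => a ⬝ᵥ u) = gaussianReal 0 (u ⬝ᵥ u).toNNReal := by
  rw [(hasGaussianLaw_dotProduct_prodMk u u).fst.map_eq_gaussianReal,
    integral_dotProduct_gaussianVec, ← covariance_self (by fun_prop),
    covariance_dotProduct_gaussianVec]

lemma measurable_dotProduct_right (u : Fin n → ℝ) :
    Measurable fun a : Fin n → ℝ => a ⬝ᵥ u := by
  unfold dotProduct; fun_prop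

lemma integral_exp_dotProduct_gaussianVec (u : Fin n → ℝ) (t : ℝ) :
    ∫ a, Real.exp (t * (a ⬝ᵥ u)) ∂gaussianVec n = Real.exp (t ^ 2 * (u ⬝ᵥ u) / 2) := by
  have h := mgf_gaussianReal (map_dotProduct_gaussianVec u) t
  have h0 : 0 ≤ u ⬝ᵥ u := by simpa using dotProduct_star_self_nonneg u
  rw [mgf, Real.coe_toNNReal _ h0] at h
  rw [h]; ring_nf

lemma integrable_exp_dotProduct_gaussianVec (u : Fin n → ℝ) (t : ℝ) :
    Integrable (fun a => Real.exp (t * (a ⬝ᵥ u))) (gaussianVec n) := by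
  by_contra h
  have := integral_undef h
  rw [integral_exp_dotProduct_gaussianVec] at this
  exact (Real.exp_pos _).ne' this

/-- The truncated identity `y ↦ y · 1{y² ≤ α}`. -/
noncomputable def trunc (α y : ℝ) : ℝ := y * if y ^ 2 ≤ α then 1 else 0

lemma measurable_trunc (α : ℝ) : Measurable (trunc α) :=
  measurable_id.mul (Measurable.ite (measurableSet_le (by fun_prop) (by fun_prop))
    measurable_const measurable_const)

lemma abs_trunc_le (α y : ℝ) : |trunc α y| ≤ √α := by
  unfold trunc
  split_ifs with h
  · simpa using Real.abs_le_sqrt h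
  · simp

lemma integrable_dotProduct_mul_trunc (w x : Fin n → ℝ) (α : ℝ) :
    Integrable (fun a => (a ⬝ᵥ w) * trunc α (a ⬝ᵥ x)) (gaussianVec n) := by
  refine (hasGaussianLaw_dotProduct_prodMk w w).fst.integrable.mul_bdd (c := √α) ?_ ?_
  · exact ((measurable_trunc α).comp (measurable_dotProduct_right x)).aestronglyMeasurable
  · exact ae_of_all _ fun a => by simpa using abs_trunc_le α _

lemma vnorm_sq {ι : Type*} [Fintype ι] (v : ι → ℝ) : vnorm v ^ 2 = v ⬝ᵥ v := by
  rw [vnorm, Real.sq_sqrt (Finset.sum_nonneg fun _ _ => sq_nonneg _)]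
  simp [dotProduct, sq]

lemma integral_dotProduct_self_mul_trunc (x : Fin n → ℝ) (α : ℝ) :
    ∫ a, (a ⬝ᵥ x) * trunc α (a ⬝ᵥ x) ∂gaussianVec n = (x ⬝ᵥ x) * betaK (vnorm x) α := by
  have hm : Measurable fun y : ℝ => y * trunc α y := measurable_id.mul (measurable_trunc α)
  rw [← integral_map (f := fun y => y * trunc α y)
    (measurable_dotProduct_right x).aemeasurable hm.aestronglyMeasurable,
    map_dotProduct_gaussianVec]
  have h := gaussianReal_map_const_mul (μ := 0) (v := 1) (vnorm x)
  have h' : gaussianReal (vnorm x * 0) (.mk (vnorm x ^ 2) (sq_nonneg _) * 1) =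
      gaussianReal 0 (x ⬝ᵥ x).toNNReal := by
    congr 1
    · simp
    · ext
      have : 0 ≤ x ⬝ᵥ x := vnorm_sq x ▸ sq_nonneg _
      simp [vnorm_sq, this]
  rw [← h', ← h, integral_map (by fun_prop) hm.aestronglyMeasurable, betaK, ← integral_const_mul]
  refine integral_congr_ae (ae_of_all _ fun z => ?_)
  simp only [trunc, mul_pow, ← vnorm_sq]
  ring

lemma integral_dotProduct_mul_trunc (w x : Fin n → ℝ) (α : ℝ) :
    ∫ a, (a ⬝ᵥ w) * trunc α (a ⬝ᵥ x) ∂gaussianVec n = (w ⬝ᵥ x) * betaK (vnorm x) α := by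
  by_cases hx : x = 0
  · simp [hx, trunc]
  have hxx : x ⬝ᵥ x ≠ 0 := by simpa [dotProduct_self_eq_zero] using hx
  set c := (w ⬝ᵥ x) / (x ⬝ᵥ x) with hc
  set w' := w - c • x with hw'
  have horth : w' ⬝ᵥ x = 0 := by
    simp [hw', sub_dotProduct, hc, div_mul_cancel₀ _ hxx]
  have hind : IndepFun (fun a : Fin n → ℝ => a ⬝ᵥ w') (fun a => a ⬝ᵥ x) (gaussianVec n) :=
    (hasGaussianLaw_dotProduct_prodMk w' x).indepFun_of_covariance_eq_zero
      (by rw [covariance_dotProduct_gaussianVec, horth])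
  have hzero : ∫ a, (a ⬝ᵥ w') * trunc α (a ⬝ᵥ x) ∂gaussianVec n = 0 := by
    have := (hind.comp measurable_id (measurable_trunc α)).integral_fun_mul_eq_mul_integral
      (measurable_dotProduct_right w').aestronglyMeasurable
      ((measurable_trunc α).comp (measurable_dotProduct_right x)).aestronglyMeasurable
    simp only [Function.comp_def, id, integral_dotProduct_gaussianVec, zero_mul] at this
    exact this
  have hsplit : ∀ a : Fin n → ℝ, (a ⬝ᵥ w) * trunc α (a ⬝ᵥ x) =
      (a ⬝ᵥ w') * trunc α (a ⬝ᵥ x) + c * ((a ⬝ᵥ x) * trunc α (a ⬝ᵥ x)) := by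
    intro a
    simp only [hw', dotProduct_sub, dotProduct_smul, smul_eq_mul]
    ring
  simp only [hsplit]
  rw [integral_add (integrable_dotProduct_mul_trunc _ _ _)
    ((integrable_dotProduct_mul_trunc _ _ _).const_mul c), hzero, integral_const_mul,
    integral_dotProduct_self_mul_trunc, zero_add, hc]
  field_simp

/-- The centred variable `⟨a, w⟩ · trunc α ⟨a, x⟩` is sub-Gaussian with variance proxy
`2 α ‖w‖²`. -/
lemma lintegral_exp_dotProduct_mul_trunc_sub_le (w x : Fin n → ℝ) {α : ℝ} (hα : 0 ≤ α) :
    ∫⁻ a, ENNReal.ofReal (Real.exp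
      ((a ⬝ᵥ w) * trunc α (a ⬝ᵥ x) - (w ⬝ᵥ x) * betaK (vnorm x) α)) ∂gaussianVec n ≤
    ENNReal.ofReal (Real.exp (α * (w ⬝ᵥ w))) := by
  set Z : (Fin n → ℝ) → ℝ := fun a => (a ⬝ᵥ w) * trunc α (a ⬝ᵥ x) with hZ
  have hZm : Measurable Z := (measurable_dotProduct_right w).mul
    ((measurable_trunc α).comp (measurable_dotProduct_right x))
  set s := √α
  set L : (Fin n → ℝ) → ℝ := fun a => a ⬝ᵥ w
  have hZL : ∀ a, |Z a| ≤ |s * L a| := fun a => by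
    rw [hZ, abs_mul, abs_mul, mul_comm, abs_of_nonneg (Real.sqrt_nonneg α)]
    exact mul_le_mul_of_nonneg_right (abs_trunc_le _ _) (abs_nonneg _)
  have hcosh : ∀ a, Real.exp (Z a) + Real.exp (-Z a) ≤
      Real.exp (s * L a) + Real.exp (-s * L a) := fun a => by
    have := Real.cosh_le_cosh.2 (hZL a)
    rw [Real.cosh_eq, Real.cosh_eq] at this
    rw [neg_mul]; linarith
  have hIL := integrable_exp_dotProduct_gaussianVec w s
  have hIL' := integrable_exp_dotProduct_gaussianVec w (-s)
  have hIZ : Integrable (fun a => Real.exp (Z a)) (gaussianVec n) := by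
    refine (hIL.add hIL').mono' (by fun_prop) (ae_of_all _ fun a => ?_)
    rw [Real.norm_eq_abs, abs_of_pos (Real.exp_pos _)]
    exact le_trans (by linarith [Real.exp_pos (-Z a)]) (hcosh a)
  have hIZ' : Integrable (fun a => Real.exp (-Z a)) (gaussianVec n) := by
    refine (hIL.add hIL').mono' (by fun_prop) (ae_of_all _ fun a => ?_)
    rw [Real.norm_eq_abs, abs_of_pos (Real.exp_pos _)]
    exact le_trans (by linarith [Real.exp_pos (Z a)]) (hcosh a)
  have hmean : ∫ a, -Z a ∂gaussianVec n = -((w ⬝ᵥ x) * betaK (vnorm x) α) := by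
    rw [integral_neg, integral_dotProduct_mul_trunc]
  have hjensen : Real.exp (-((w ⬝ᵥ x) * betaK (vnorm x) α)) ≤
      ∫ a, Real.exp (-Z a) ∂gaussianVec n := by
    rw [← hmean]
    exact convexOn_exp.map_integral_le Real.continuous_exp.continuousOn isClosed_univ
      (by simp) (integrable_dotProduct_mul_trunc w x α).neg hIZ'
  have hsum : (∫ a, Real.exp (Z a) ∂gaussianVec n) + ∫ a, Real.exp (-Z a) ∂gaussianVec n ≤
      2 * Real.exp (α * (w ⬝ᵥ w) / 2) := by
    rw [← integral_add hIZ hIZ']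
    refine (integral_mono (hIZ.add hIZ') (hIL.add hIL') hcosh).trans_eq ?_
    rw [Pi.add_def, integral_add hIL hIL', integral_exp_dotProduct_gaussianVec,
      integral_exp_dotProduct_gaussianVec, neg_sq, Real.sq_sqrt hα, two_mul]
  have hexp : Real.exp (α * (w ⬝ᵥ w)) = Real.exp (α * (w ⬝ᵥ w) / 2) ^ 2 := by
    rw [← Real.exp_nat_mul]; congr 1; push_cast; ring
  have hA : 0 ≤ ∫ a, Real.exp (Z a) ∂gaussianVec n := integral_nonneg fun _ => (Real.exp_pos _).le
  have hB : 0 ≤ ∫ a, Real.exp (-Z a) ∂gaussianVec n := integral_nonneg fun _ => (Real.exp_pos _).le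
  simp only [sub_eq_add_neg, Real.exp_add]
  rw [← ofReal_integral_eq_lintegral_ofReal (hIZ.mul_const _)
    (ae_of_all _ fun a => by positivity), integral_mul_const]
  refine ENNReal.ofReal_le_ofReal ((mul_le_mul_of_nonneg_left hjensen hA).trans ?_)
  rw [hexp]
  nlinarith [sq_nonneg ((∫ a, Real.exp (Z a) ∂gaussianVec n) -
    ∫ a, Real.exp (-Z a) ∂gaussianVec n), Real.exp_pos (α * (w ⬝ᵥ w) / 2)]

end GaussianVec

section PiExp

lemma lintegral_pi_exp_sum {ι : Type*} [Fintype ι] {E : ι → Type*}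
    [∀ i, MeasurableSpace (E i)] (μ : ∀ i, Measure (E i)) [∀ i, IsProbabilityMeasure (μ i)]
    (f : ∀ i, E i → ℝ) (hf : ∀ i, Measurable (f i)) :
    ∫⁻ x, ENNReal.ofReal (Real.exp (∑ i, f i (x i))) ∂Measure.pi μ =
      ∏ i, ∫⁻ y, ENNReal.ofReal (Real.exp (f i y)) ∂μ i := by
  have hm : ∀ i, Measurable fun y => ENNReal.ofReal (Real.exp (f i y)) := fun i => by fun_prop
  simp only [Real.exp_sum, ENNReal.ofReal_prod_of_nonneg fun _ _ => (Real.exp_pos _).le]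
  rw [lintegral_prod_eq_prod_lintegral_of_indepFun Finset.univ _
    (iIndepFun_pi fun i => (hm i).aemeasurable) fun i => (hm i).comp (measurable_pi_apply i)]
  exact Finset.prod_congr rfl fun i _ => (measurePreserving_eval μ i).lintegral_comp (hm i)

lemma lintegral_exp_sq_div_four_stdGaussian :
    ∫⁻ z, ENNReal.ofReal (Real.exp (z ^ 2 / 4)) ∂_root_.stdGaussian = ENNReal.ofReal √2 := by
  rw [_root_.stdGaussian, gaussianReal_of_var_ne_zero _ one_ne_zero,
    lintegral_withDensity_eq_lintegral_mul _ (measurable_gaussianPDF _ _) (by fun_prop)]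
  have hpt : ∀ z : ℝ, (gaussianPDF 0 1 * fun z => ENNReal.ofReal (Real.exp (z ^ 2 / 4))) z =
      ENNReal.ofReal ((√(2 * Real.pi))⁻¹ * Real.exp (-(1 / 4) * z ^ 2)) := fun z => by
    rw [Pi.mul_apply, gaussianPDF, ← ENNReal.ofReal_mul (gaussianPDFReal_nonneg _ _ _),
      gaussianPDFReal, mul_assoc, ← Real.exp_add]
    simp only [NNReal.coe_one, mul_one, sub_zero]
    ring_nf
  simp only [hpt]
  rw [← ofReal_integral_eq_lintegral_ofReal
    ((integrable_exp_neg_mul_sq (by norm_num)).const_mul _) (ae_of_all _ fun z => by positivity),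
    integral_const_mul, integral_gaussian, inv_mul_eq_div, ← Real.sqrt_div (by positivity)]
  congr 2
  field_simp
  norm_num

variable {n r : ℕ}

lemma lintegral_exp_inner_gaussianMatrix (M : Matrix (Fin n) (Fin r) ℝ) (t : ℝ) :
    ∫⁻ g, ENNReal.ofReal (Real.exp (∑ j, t * (g j ⬝ᵥ M j)))
      ∂(Measure.pi fun _ : Fin n => gaussianVec r) =
    ENNReal.ofReal (Real.exp (t ^ 2 / 2 * ∑ j, ∑ l, M j l ^ 2)) := by
  rw [lintegral_pi_exp_sum (fun _ : Fin n => gaussianVec r) (fun j y => t * (y ⬝ᵥ M j))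
    fun j => (measurable_dotProduct_right (M j)).const_mul t]
  have h : ∀ j, ∫⁻ y, ENNReal.ofReal (Real.exp (t * (y ⬝ᵥ M j))) ∂gaussianVec r =
      ENNReal.ofReal (Real.exp (t ^ 2 / 2 * ∑ l, M j l ^ 2)) := fun j => by
    rw [← ofReal_integral_eq_lintegral_ofReal (integrable_exp_dotProduct_gaussianVec _ _)
      (ae_of_all _ fun _ => (Real.exp_pos _).le), integral_exp_dotProduct_gaussianVec]
    simp only [dotProduct, ← sq]
    ring_nf
  simp only [h]
  rw [← ENNReal.ofReal_prod_of_nonneg fun _ _ => (Real.exp_pos _).le, ← Real.exp_sum,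
    Finset.mul_sum]

lemma lintegral_exp_sum_sq_gaussianMatrix :
    ∫⁻ g, ENNReal.ofReal (Real.exp (1 / 4 * ∑ j, ∑ l, g j l ^ 2))
      ∂(Measure.pi fun _ : Fin n => gaussianVec r) = ENNReal.ofReal √2 ^ (n * r) := by
  simp only [Finset.mul_sum, one_div_mul_eq_div]
  rw [lintegral_pi_exp_sum (fun _ : Fin n => gaussianVec r) (fun _ y => ∑ l, y l ^ 2 / 4)
    fun _ => by fun_prop]
  simp only [gaussianVec]
  rw [lintegral_pi_exp_sum (fun _ : Fin r => _root_.stdGaussian) (fun _ z => z ^ 2 / 4)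
    fun _ => by fun_prop]
  simp [lintegral_exp_sq_div_four_stdGaussian, ← pow_mul, mul_comm]

end PiExp

section Tail

variable {n q r m : ℕ}

lemma frob_sq {ι ι' : Type*} [Fintype ι] [Fintype ι'] (M : Matrix ι ι' ℝ) :
    frob M ^ 2 = ∑ i, ∑ j, M i j ^ 2 :=
  Real.sq_sqrt (Finset.sum_nonneg fun _ _ => Finset.sum_nonneg fun _ _ => sq_nonneg _)

/-- The deviation `(X̂₀(α) - X D(α)) Vᵀ` of the right-projected truncated initialization. -/
noncomputable def initDev (X : Matrix (Fin n) (Fin q) ℝ) (V : Matrix (Fin r) (Fin q) ℝ) (α : ℝ)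
    (ω : Fin q → Fin m → Fin n → ℝ) : Matrix (Fin n) (Fin r) ℝ :=
  (initMat (fun k => matCol X k) α ω -
    X * Matrix.diagonal fun k => betaK (vnorm (matCol X k)) α) * Vᵀ

lemma initMat_apply (x : Fin q → Fin n → ℝ) (α : ℝ) (ω : Fin q → Fin m → Fin n → ℝ)
    (j : Fin n) (k : Fin q) :
    initMat x α ω j k = (1 / (m : ℝ)) * ∑ i, ω k i j * trunc α (ω k i ⬝ᵥ x k) := by
  simp only [initMat, trunc, Matrix.of_apply, mul_assoc]

lemma measurable_initDev_apply (X : Matrix (Fin n) (Fin q) ℝ) (V : Matrix (Fin r) (Fin q) ℝ)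
    (α : ℝ) (j : Fin n) (l : Fin r) :
    Measurable fun ω : Fin q → Fin m → Fin n → ℝ => initDev X V α ω j l := by
  have ht : ∀ k i, Measurable fun ω : Fin q → Fin m → Fin n → ℝ =>
      trunc α (ω k i ⬝ᵥ matCol X k) := fun k i =>
    (measurable_trunc α).comp ((measurable_dotProduct_right _).comp (by fun_prop))
  simp only [initDev, Matrix.mul_apply, Matrix.sub_apply, initMat_apply]
  fun_prop

/-- Duality between the deviation and a test matrix `g`, as a sum of independent terms. -/
lemma sum_dotProduct_initDev (hm : m ≠ 0) (X : Matrix (Fin n) (Fin q) ℝ)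
    (V : Matrix (Fin r) (Fin q) ℝ) (α t : ℝ) (ω : Fin q → Fin m → Fin n → ℝ)
    (g : Matrix (Fin n) (Fin r) ℝ) :
    ∑ j, t * (g j ⬝ᵥ initDev X V α ω j) =
      ∑ k, ∑ i, ((ω k i ⬝ᵥ (t / m) • matCol (g * V) k) * trunc α (ω k i ⬝ᵥ matCol X k) -
        ((t / m) • matCol (g * V) k ⬝ᵥ matCol X k) * betaK (vnorm (matCol X k)) α) := by
  have hm' : (m : ℝ) ≠ 0 := Nat.cast_ne_zero.2 hm
  have hswap : ∀ E : Matrix (Fin n) (Fin q) ℝ, ∑ j, t * (g j ⬝ᵥ (E * Vᵀ) j) =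
      ∑ k, t * ∑ j, E j k * (g * V) j k := fun E => by
    simp only [dotProduct, Matrix.mul_apply, Matrix.transpose_apply, Finset.mul_sum]
    rw [Finset.sum_comm (s := (Finset.univ : Finset (Fin q)))]
    refine Finset.sum_congr rfl fun j _ => ?_
    rw [Finset.sum_comm]
    refine Finset.sum_congr rfl fun k _ => Finset.sum_congr rfl fun l _ => ?_
    ring
  rw [initDev, hswap]
  refine Finset.sum_congr rfl fun k _ => ?_
  rw [Finset.sum_sub_distrib]
  simp only [Matrix.sub_apply, initMat_apply, Matrix.mul_diagonal, sub_mul,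
    Finset.sum_sub_distrib, mul_sub]
  congr 1
  · simp only [dotProduct_smul, smul_eq_mul]
    simp only [dotProduct, matCol, Finset.mul_sum, Finset.sum_mul]
    rw [Finset.sum_comm]
    refine Finset.sum_congr rfl fun i _ => Finset.sum_congr rfl fun j _ => ?_
    ring
  · rw [Finset.sum_const, Finset.card_univ, Fintype.card_fin, nsmul_eq_mul, smul_dotProduct,
      smul_eq_mul]
    simp only [dotProduct, matCol, Finset.mul_sum, Finset.sum_mul]
    refine Finset.sum_congr rfl fun j _ => ?_
    field_simp

lemma sum_dotProduct_matCol_mul {V : Matrix (Fin r) (Fin q) ℝ} (hV : V * Vᵀ = 1)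
    (g : Matrix (Fin n) (Fin r) ℝ) :
    ∑ k, matCol (g * V) k ⬝ᵥ matCol (g * V) k = ∑ j, ∑ l, g j l ^ 2 := by
  have h1 : ((g * V) * (g * V)ᵀ).trace = (g * gᵀ).trace := by
    rw [Matrix.transpose_mul, Matrix.mul_assoc, ← Matrix.mul_assoc V, hV, Matrix.one_mul]
  simp only [Matrix.trace, Matrix.diag_apply] at h1
  simp only [Matrix.mul_apply (M := g * V), Matrix.mul_apply (M := g) (N := gᵀ),
    Matrix.transpose_apply] at h1
  simp only [sq, ← h1, dotProduct, matCol]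
  exact Finset.sum_comm

lemma lintegral_exp_sum_dotProduct_initDev_le (hm : m ≠ 0) (X : Matrix (Fin n) (Fin q) ℝ)
    {V : Matrix (Fin r) (Fin q) ℝ} (hV : V * Vᵀ = 1) {α : ℝ} (hα : 0 ≤ α) (t : ℝ)
    (g : Matrix (Fin n) (Fin r) ℝ) :
    ∫⁻ ω, ENNReal.ofReal (Real.exp (∑ j, t * (g j ⬝ᵥ initDev X V α ω j)))
      ∂gaussianMatrices q m n ≤
    ENNReal.ofReal (Real.exp (α * t ^ 2 / m * ∑ j, ∑ l, g j l ^ 2)) := by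
  have hm' : (m : ℝ) ≠ 0 := Nat.cast_ne_zero.2 hm
  simp only [sum_dotProduct_initDev hm]
  set F : Fin q → (Fin n → ℝ) → ℝ := fun k a =>
    (a ⬝ᵥ (t / m) • matCol (g * V) k) * trunc α (a ⬝ᵥ matCol X k) -
      ((t / m) • matCol (g * V) k ⬝ᵥ matCol X k) * betaK (vnorm (matCol X k)) α with hF
  have hFm : ∀ k, Measurable (F k) := fun k =>
    ((measurable_dotProduct_right _).mul
      ((measurable_trunc α).comp (measurable_dotProduct_right _))).sub_const _
  have hsm : ∀ k, Measurable fun b : Fin m → Fin n → ℝ => ∑ i, F k (b i) := fun k =>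
    Finset.measurable_sum _ fun i _ => (hFm k).comp (measurable_pi_apply i)
  rw [gaussianMatrices, lintegral_pi_exp_sum
    (fun _ : Fin q => Measure.pi fun _ : Fin m => gaussianVec n) (fun k b => ∑ i, F k (b i)) hsm]
  simp only [fun k => lintegral_pi_exp_sum (fun _ : Fin m => gaussianVec n)
    (fun _ => F k) fun _ => hFm k]
  refine (Finset.prod_le_prod' fun k _ => Finset.prod_le_prod' fun i _ =>
    lintegral_exp_dotProduct_mul_trunc_sub_le _ _ hα).trans_eq ?_
  simp only [← ENNReal.ofReal_prod_of_nonneg fun _ _ => (Real.exp_pos _).le, ← Real.exp_sum]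
  rw [← sum_dotProduct_matCol_mul hV g, Finset.mul_sum]
  congr 2
  refine Finset.sum_congr rfl fun k _ => ?_
  rw [Finset.sum_const, Finset.card_univ, Fintype.card_fin, nsmul_eq_mul, smul_dotProduct,
    dotProduct_smul, smul_eq_mul, smul_eq_mul]
  field_simp

lemma lintegral_exp_frob_sq_initDev_le (hm : m ≠ 0) (X : Matrix (Fin n) (Fin q) ℝ)
    {V : Matrix (Fin r) (Fin q) ℝ} (hV : V * Vᵀ = 1) {α : ℝ} (hα : 0 < α) :
    ∫⁻ ω, ENNReal.ofReal (Real.exp (m / (8 * α) * frob (initDev X V α ω) ^ 2))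
      ∂gaussianMatrices q m n ≤ ENNReal.ofReal √2 ^ (n * r) := by
  have hm' : (0 : ℝ) < m := Nat.cast_pos.2 (Nat.pos_of_ne_zero hm)
  set t : ℝ := √(m / (4 * α)) with ht
  have ht2 : t ^ 2 = m / (4 * α) := Real.sq_sqrt (by positivity)
  have hmeas : Measurable (Function.uncurry fun (ω : Fin q → Fin m → Fin n → ℝ)
      (g : Fin n → Fin r → ℝ) =>
        ENNReal.ofReal (Real.exp (∑ j, t * (g j ⬝ᵥ initDev X V α ω j)))) := by
    have h : ∀ j l, Measurable fun p : (Fin q → Fin m → Fin n → ℝ) × (Fin n → Fin r → ℝ) =>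
        initDev X V α p.1 j l := fun j l =>
      (measurable_initDev_apply X V α j l).comp measurable_fst
    simp only [Function.uncurry_def, dotProduct]
    fun_prop
  calc ∫⁻ ω, ENNReal.ofReal (Real.exp (m / (8 * α) * frob (initDev X V α ω) ^ 2))
        ∂gaussianMatrices q m n
      = ∫⁻ ω, ∫⁻ g, ENNReal.ofReal (Real.exp (∑ j, t * (g j ⬝ᵥ initDev X V α ω j)))
          ∂(Measure.pi fun _ : Fin n => gaussianVec r) ∂gaussianMatrices q m n := by
        refine lintegral_congr fun ω => ?_
        rw [lintegral_exp_inner_gaussianMatrix, frob_sq, ht2]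
        congr 3
        field_simp
        norm_num
    _ = ∫⁻ g, ∫⁻ ω, ENNReal.ofReal (Real.exp (∑ j, t * (g j ⬝ᵥ initDev X V α ω j)))
          ∂gaussianMatrices q m n ∂(Measure.pi fun _ : Fin n => gaussianVec r) :=
        lintegral_lintegral_swap hmeas.aemeasurable
    _ ≤ ∫⁻ g, ENNReal.ofReal (Real.exp (1 / 4 * ∑ j, ∑ l, g j l ^ 2))
          ∂(Measure.pi fun _ : Fin n => gaussianVec r) := by
        refine lintegral_mono fun g => ?_
        have h := lintegral_exp_sum_dotProduct_initDev_le hm X hV hα.le t g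
        have hc : α * t ^ 2 / m = 1 / 4 := by rw [ht2]; field_simp
        rwa [hc] at h
    _ = ENNReal.ofReal √2 ^ (n * r) := lintegral_exp_sum_sq_gaussianMatrix

/-- Sub-Gaussian tail bound for the Frobenius norm of the deviation. -/
lemma measure_lt_frob_initDev_le (hm : m ≠ 0) (X : Matrix (Fin n) (Fin q) ℝ)
    {V : Matrix (Fin r) (Fin q) ℝ} (hV : V * Vᵀ = 1) {α : ℝ} (hα : 0 < α) {s : ℝ} (hs : 0 ≤ s) :
    gaussianMatrices q m n {ω | s < frob (initDev X V α ω)} ≤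
      ENNReal.ofReal (Real.exp (n * r - m / (8 * α) * s ^ 2)) := by
  set b : ℝ := m / (8 * α) * s ^ 2 with hb
  have hsub : {ω : Fin q → Fin m → Fin n → ℝ | s < frob (initDev X V α ω)} ⊆
      {ω | ENNReal.ofReal (Real.exp b) ≤
        ENNReal.ofReal (Real.exp (m / (8 * α) * frob (initDev X V α ω) ^ 2))} := fun ω hω => by
    have : s ^ 2 ≤ frob (initDev X V α ω) ^ 2 := pow_le_pow_left₀ hs (le_of_lt hω) 2
    exact ENNReal.ofReal_le_ofReal (Real.exp_le_exp.2
      (mul_le_mul_of_nonneg_left this (by positivity)))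
  have hmeas : Measurable fun ω : Fin q → Fin m → Fin n → ℝ =>
      ENNReal.ofReal (Real.exp (m / (8 * α) * frob (initDev X V α ω) ^ 2)) := by
    have h := measurable_initDev_apply (m := m) X V α
    simp only [frob_sq]
    fun_prop
  refine (measure_mono hsub).trans ((meas_ge_le_lintegral_div hmeas.aemeasurable
    (by simp [Real.exp_pos]) ENNReal.ofReal_ne_top).trans ?_)
  have h2 : √2 ≤ Real.exp 1 := by
    rw [Real.sqrt_le_left (Real.exp_pos 1).le]
    nlinarith [Real.add_one_le_exp 1]
  calc _ ≤ ENNReal.ofReal √2 ^ (n * r) / ENNReal.ofReal (Real.exp b) := by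
        gcongr
        exact lintegral_exp_frob_sq_initDev_le hm X hV hα
    _ = ENNReal.ofReal (√2 ^ (n * r) / Real.exp b) := by
        rw [ENNReal.ofReal_div_of_pos (Real.exp_pos _), ENNReal.ofReal_pow (Real.sqrt_nonneg 2)]
    _ ≤ _ := by
        rw [Real.exp_sub]
        gcongr
        calc √2 ^ (n * r) ≤ Real.exp 1 ^ (n * r) := by gcongr
          _ = Real.exp (n * r) := by rw [← Real.exp_nat_mul]; simp

end Tail

/-- **Lemma 3.8, part 3** (concentration of the right-projected truncated initialization,
fixed threshold). -/
theorem lemma38_part3 :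
    ∃ c : ℝ, 0 < c ∧
    ∀ (n q r m : ℕ) (Ustar : Matrix (Fin n) (Fin r) ℝ) (Btil : Matrix (Fin r) (Fin q) ℝ)
      (V : Matrix (Fin r) (Fin q) ℝ) (μ ε₁ σp σm κ α : ℝ),
      Ustarᵀ * Ustar = 1 → Btil.rank = r →
      σp = spec (Ustar * Btil) → σm = sigMin Btil → κ = σp / σm →
      1 ≤ μ → (∀ k, vnorm (matCol Btil k) ≤ μ * σp * Real.sqrt ((r : ℝ) / q)) →
      0 < ε₁ → ε₁ < 1 →
      V * Vᵀ = 1 →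
      9 * κ ^ 2 * μ ^ 2 * (1 - ε₁) * frob (Ustar * Btil) ^ 2 / q ≤ α →
      α ≤ 9 * κ ^ 2 * μ ^ 2 * (1 + ε₁) * frob (Ustar * Btil) ^ 2 / q →
      ENNReal.ofReal (1 - Real.exp ((n : ℝ) * r - c * ε₁ ^ 2 * m * q / (μ ^ 2 * κ ^ 2))) ≤
        gaussianMatrices q m n {ω |
          frob ((initMat (fun k => matCol (Ustar * Btil) k) α ω -
              (Ustar * Btil) * Matrix.diagonal (fun k =>
                betaK (vnorm (matCol (Ustar * Btil) k)) α)) * Vᵀ) ≤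
            1.1 * ε₁ * frob (Ustar * Btil)} := by
  refine ⟨1 / 144, by norm_num, ?_⟩
  intro n q r m Ustar Btil V μ ε₁ σp σm κ α _ _ _ _ _ hμ _ hε hε1 hV hαl hαu
  set X := Ustar * Btil with hX
  by_cases htriv : 1 / 144 * ε₁ ^ 2 * m * q / (μ ^ 2 * κ ^ 2) = 0
  · rw [htriv, ENNReal.ofReal_of_nonpos]
    · exact zero_le
    · have := Real.one_le_exp (show (0 : ℝ) ≤ n * r - 0 by simp; positivity)
      linarith
  have hm : m ≠ 0 := by rintro rfl; simp at htriv
  have hq : q ≠ 0 := by rintro rfl; simp at htriv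
  have hκ : κ ≠ 0 := by rintro rfl; simp at htriv
  have hm' : (0 : ℝ) < m := Nat.cast_pos.2 (Nat.pos_of_ne_zero hm)
  have hq' : (0 : ℝ) < q := Nat.cast_pos.2 (Nat.pos_of_ne_zero hq)
  have hμ' : 0 < μ := by linarith
  have hf0 : 0 ≤ frob X := Real.sqrt_nonneg _
  change _ ≤ gaussianMatrices q m n {ω | frob (initDev X V α ω) ≤ 1.1 * ε₁ * frob X}
  rcases hf0.eq_or_lt with hf | hf
  · have hX0 : X = 0 := by
      have h := frob_sq X
      rw [← hf, zero_pow two_ne_zero] at h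
      ext i j
      have hi := (Finset.sum_eq_zero_iff_of_nonneg fun _ _ =>
        Finset.sum_nonneg fun _ _ => sq_nonneg _).1 h.symm i (Finset.mem_univ i)
      have hij := (Finset.sum_eq_zero_iff_of_nonneg fun _ _ => sq_nonneg _).1 hi j
        (Finset.mem_univ j)
      simpa using hij
    have hdev : ∀ ω : Fin q → Fin m → Fin n → ℝ, initDev X V α ω = 0 := fun ω => by
      have h0 : ∀ k, matCol X k = 0 := fun k => by ext i; simp [hX0, matCol]
      have : initMat (fun k => matCol X k) α ω = 0 := by
        ext j k
        simp [initMat_apply, h0, trunc]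
      rw [initDev, this, hX0]; simp
    have huniv : {ω : Fin q → Fin m → Fin n → ℝ |
        frob (initDev X V α ω) ≤ 1.1 * ε₁ * frob X} = Set.univ := by
      ext ω; simp [hdev, ← hf, show frob (0 : Matrix (Fin n) (Fin r) ℝ) = 0 by simp [frob]]
    rw [huniv, measure_univ]
    exact ENNReal.ofReal_le_one.2 (sub_le_self _ (Real.exp_pos _).le)
  · have hα : 0 < α := lt_of_lt_of_le (by have := sub_pos.2 hε1; positivity) hαl
    have hα18 : α ≤ 18 * κ ^ 2 * μ ^ 2 * frob X ^ 2 / q := by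
      calc α ≤ 9 * κ ^ 2 * μ ^ 2 * (1 + ε₁) * frob X ^ 2 / q := hαu
        _ ≤ 9 * κ ^ 2 * μ ^ 2 * 2 * frob X ^ 2 / q := by
          gcongr
          linarith
        _ = 18 * κ ^ 2 * μ ^ 2 * frob X ^ 2 / q := by ring
    have hexp : 1 / 144 * ε₁ ^ 2 * m * q / (μ ^ 2 * κ ^ 2) ≤
        m / (8 * α) * (1.1 * ε₁ * frob X) ^ 2 := by
      calc 1 / 144 * ε₁ ^ 2 * m * q / (μ ^ 2 * κ ^ 2)
          = m / (8 * (18 * κ ^ 2 * μ ^ 2 * frob X ^ 2 / q)) * (ε₁ * frob X) ^ 2 := by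
            field_simp; norm_num
        _ ≤ m / (8 * α) * (1.1 * ε₁ * frob X) ^ 2 := by
            gcongr
            nlinarith
    have htail := measure_lt_frob_initDev_le (m := m) hm X hV hα
      (s := 1.1 * ε₁ * frob X) (by positivity)
    have hcompl : {ω : Fin q → Fin m → Fin n → ℝ | 1.1 * ε₁ * frob X < frob (initDev X V α ω)} =
        {ω | frob (initDev X V α ω) ≤ 1.1 * ε₁ * frob X}ᶜ := by
      ext ω; simp
    rw [hcompl] at htail
    rw [ENNReal.ofReal_sub _ (Real.exp_pos _).le, ENNReal.ofReal_one, tsub_le_iff_right]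
    calc (1 : ℝ≥0∞) = gaussianMatrices q m n Set.univ := measure_univ.symm
      _ ≤ gaussianMatrices q m n {ω | frob (initDev X V α ω) ≤ 1.1 * ε₁ * frob X} +
          gaussianMatrices q m n {ω | frob (initDev X V α ω) ≤ 1.1 * ε₁ * frob X}ᶜ := by
        rw [← Set.union_compl_self {ω | frob (initDev X V α ω) ≤ 1.1 * ε₁ * frob X}]
        exact measure_union_le _ _
      _ ≤ _ := by
        gcongr
        exact htail.trans (ENNReal.ofReal_le_ofReal (Real.exp_le_exp.2 (by linarith)))
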